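/- Let ν_t be the distribution of the free positive multiplicative Brownian motion at time t > 0, characterized by its moments ∫ x^n dν_t(x) = e^{nt/2} (1/n) ∑_{j=0}^{n-1} C(n,1+j)(nt)^j/j! for n ≥ 1. Then ν_t equals the pushforward under x ↦ e^x of μ_{sc,2√t} ⊞ Unif_{[-t/2,t/2]}. -/

import Mathlib

open MeasureTheory

/-- Signed Stirling numbers of the first kind. -/
def stirlingS1 : ℕ → ℕ → ℤ
  | 0, 0 => 1
  | 0, _ + 1 => 0
  | _ + 1, 0 => 0
  | n + 1, k + 1 => stirlingS1 n k - n * stirlingS1 n (k + 1)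

/-- The `n`-th moment of a measure on `ℝ`. -/
noncomputable def moment (μ : Measure ℝ) (n : ℕ) : ℝ := ∫ x, x ^ n ∂μ

/-- The free cumulants of a measure on `ℝ`, defined recursively through the
moment–cumulant relation `mₙ = ∑_{s=1}^n κ_s ∑_{i₁+⋯+i_s = n-s} m_{i₁} ⋯ m_{i_s}`,
which for measures with all moments finite is equivalent to the usual definition via
sums over non-crossing partitions. -/
noncomputable def freeCumulant (μ : Measure ℝ) : ℕ → ℝ
  | 0 => 0
  | n + 1 =>
    moment μ (n + 1) -
      ∑ s ∈ (Finset.range n).attach,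
        freeCumulant μ (s.1 + 1) *
          ∑ p ∈ Finset.Nat.antidiagonalTuple (s.1 + 1) (n - s.1),
            ∏ j, moment μ (p j)
  decreasing_by
    have := s.2
    simp only [Finset.mem_range] at this
    omega

/-- `IsFreeAdd μ ν ρ` asserts that `ρ` is the free additive convolution `μ ⊞ ν`,
characterized by additivity of free cumulants. -/
def IsFreeAdd (μ ν ρ : Measure ℝ) : Prop :=
  ∀ n : ℕ, freeCumulant ρ n = freeCumulant μ n + freeCumulant ν n

/-- The semicircle distribution of radius `R`. -/
noncomputable def semicircle (R : ℝ) : Measure ℝ :=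
  (volume.restrict (Set.Icc (-R) R)).withDensity fun x =>
    ENNReal.ofReal (2 / (Real.pi * R ^ 2) * Real.sqrt (R ^ 2 - x ^ 2))

/-- The uniform distribution on `[a, b]`. -/
noncomputable def unif (a b : ℝ) : Measure ℝ :=
  (ENNReal.ofReal (b - a))⁻¹ • volume.restrict (Set.Icc a b)

namespace PowerSeries

theorem coeff_pow_eq_sum_antidiagonalTuple {R : Type*} [CommSemiring R] (f : R⟦X⟧) (k n : ℕ) :
    coeff n (f ^ k) = ∑ p ∈ Finset.Nat.antidiagonalTuple k n, ∏ j, coeff (p j) f := by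
  rw [← Finset.piAntidiag_univ_fin_eq_antidiagonalTuple]
  have := coeff_prod (fun _ : Fin k => f) n Finset.univ
  simp only [Finset.prod_const, Finset.card_univ, Fintype.card_fin] at this
  rw [this]
  exact Finset.sum_equiv Finsupp.equivFunOnFinite (by simp [Finset.mem_finsuppAntidiag])
    (by simp)

/-- A fixed-point equation `B = P * f(B)` with `P` divisible by `X` has at most one solution. -/
theorem eq_of_eq_mul_subst {R : Type*} [CommRing R] {f P B₁ B₂ : R⟦X⟧} (hP : X ∣ P)
    (h₁ : B₁ = P * f.subst B₁) (h₂ : B₂ = P * f.subst B₂) : B₁ = B₂ := by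
  have const_zero {B : R⟦X⟧} (h : B = P * f.subst B) : HasSubst B := by
    apply HasSubst.of_constantCoeff_zero'
    rw [← X_dvd_iff, h]
    exact hP.mul_right _
  have key (n : ℕ) : X ^ n ∣ B₁ - B₂ := by
    induction n with
    | zero => simp
    | succ n ih =>
      have h : X ^ n ∣ f.subst B₁ - f.subst B₂ := by
        rw [X_pow_dvd_iff]
        intro m hm
        rw [map_sub, coeff_subst' (const_zero h₁), coeff_subst' (const_zero h₂), sub_eq_zero]
        refine finsum_congr fun d => ?_
        congr 1
        have := X_pow_dvd_iff.mp (ih.trans (sub_dvd_pow_sub_pow B₁ B₂ d)) m hm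
        rwa [map_sub, sub_eq_zero] at this
      have hsub : B₁ - B₂ = P * (f.subst B₁ - f.subst B₂) := by rw [mul_sub, ← h₁, ← h₂]
      rw [hsub, pow_succ']
      exact mul_dvd_mul hP h
  rw [← sub_eq_zero]
  ext n
  simpa using X_pow_dvd_iff.mp (key (n + 1)) n n.lt_succ_self

theorem coeff_subst_eq_sum_range {R : Type*} [CommRing R] {f B : R⟦X⟧}
    (hB : constantCoeff B = 0) {n N : ℕ} (hN : n < N) :
    coeff n (f.subst B) = ∑ d ∈ Finset.range N, coeff d f * coeff n (B ^ d) := by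
  rw [coeff_subst' (HasSubst.of_constantCoeff_zero' hB)]
  simp only [smul_eq_mul]
  refine finsum_eq_sum_of_support_subset _ fun d hd => ?_
  by_contra hd'
  have hd' : N ≤ d := by simpa using hd'
  refine hd ?_
  have h := X_pow_dvd_iff.mp (pow_dvd_pow_of_dvd (X_dvd_iff.mpr hB) d) n (hN.trans_le hd')
  simp [h]

theorem coeff_pow_sub_mul_derivative {h : ℝ⟦X⟧} (m : ℕ) (hm : m ≠ 0) :
    coeff m (h ^ m - X * h ^ (m - 1) * d⁄dX ℝ h) = 0 := by
  obtain ⟨m, rfl⟩ := Nat.exists_eq_succ_of_ne_zero hm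
  have h1 : d⁄dX ℝ (h ^ (m + 1)) = C ((m : ℝ) + 1) * (h ^ m * d⁄dX ℝ h) := by
    rw [derivative_pow]; simp [mul_assoc]
  have h2 := congrArg (coeff m) h1
  rw [coeff_derivative, coeff_C_mul, mul_comm] at h2
  have h3 := mul_left_cancel₀ (by positivity) h2
  simp only [Nat.succ_eq_add_one, Nat.add_sub_cancel, map_sub, mul_assoc, coeff_succ_X_mul, h3,
    sub_self]

/-- The **Lagrange inversion formula**: if `A(X / h) = G`, then
`n [Xⁿ] A = [Xⁿ⁻¹] (hⁿ · dG/dX)`. -/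
theorem coeff_of_subst_X_mul_inv_eq {A G h : ℝ⟦X⟧} (hh : constantCoeff h ≠ 0)
    (hA : A.subst (X * h⁻¹) = G) (k : ℕ) :
    coeff k (h ^ (k + 1) * d⁄dX ℝ G) = (k + 1) * coeff (k + 1) A := by
  have hP0 : constantCoeff (X * h⁻¹) = 0 := by simp
  have hP := HasSubst.of_constantCoeff_zero' hP0
  have hinv : h * h⁻¹ = 1 := PowerSeries.mul_inv_cancel h hh
  have hdP : d⁄dX ℝ (X * h⁻¹) = h⁻¹ ^ 2 * (h - X * d⁄dX ℝ h) := by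
    simp only [Derivation.leibniz, derivative_inv', derivative_X, smul_eq_mul]
    linear_combination (-h⁻¹) * hinv
  rw [← hA, derivative_subst hP, ← mul_assoc, mul_right_comm, coeff_mul]
  have expand (p : ℕ × ℕ) (hp : p ∈ Finset.HasAntidiagonal.antidiagonal k) :
      coeff p.2 ((d⁄dX ℝ A).subst (X * h⁻¹)) =
        ∑ d ∈ Finset.range (k + 1), coeff d (d⁄dX ℝ A) * coeff p.2 ((X * h⁻¹) ^ d) :=
    coeff_subst_eq_sum_range hP0 (by have := Finset.HasAntidiagonal.mem_antidiagonal.mp hp; omega)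
  rw [Finset.sum_congr rfl fun p hp => by rw [expand p hp, Finset.mul_sum], Finset.sum_comm]
  have inner (d : ℕ) (hd : d ∈ Finset.range (k + 1)) :
      ∑ p ∈ Finset.HasAntidiagonal.antidiagonal k, coeff p.1 (h ^ (k + 1) * d⁄dX ℝ (X * h⁻¹)) *
        (coeff d (d⁄dX ℝ A) * coeff p.2 ((X * h⁻¹) ^ d)) =
      coeff d (d⁄dX ℝ A) * if d = k then 1 else 0 := by
    simp only [mul_left_comm _ (coeff d (d⁄dX ℝ A)), ← Finset.mul_sum]
    rw [← coeff_mul, hdP]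
    congr 1
    obtain ⟨m, rfl⟩ := Nat.exists_eq_add_of_le (Nat.lt_succ_iff.mp (Finset.mem_range.mp hd))
    have hcancel : h ^ (d + m + 1) * (h⁻¹ ^ 2 * (h - X * d⁄dX ℝ h)) * (X * h⁻¹) ^ d =
        X ^ d * (h ^ m * h⁻¹ * (h - X * d⁄dX ℝ h)) := by
      have : h ^ (d + 1) * h⁻¹ ^ (d + 1) = 1 := by rw [← mul_pow, hinv, one_pow]
      linear_combination (X ^ d * h ^ m * h⁻¹ * (h - X * d⁄dX ℝ h)) * this
    rw [hcancel, add_comm d m, coeff_X_pow_mul]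
    rcases Nat.eq_zero_or_pos m with rfl | hm
    · simp [hh]
    · rw [if_neg (by omega), ← coeff_pow_sub_mul_derivative (h := h) m hm.ne']
      congr 1
      obtain ⟨m, rfl⟩ := Nat.exists_eq_succ_of_ne_zero hm.ne'
      simp only [Nat.succ_eq_add_one, Nat.add_sub_cancel]
      linear_combination (h ^ m * (h - X * d⁄dX ℝ h)) * hinv
  rw [Finset.sum_congr rfl inner]
  simp [coeff_derivative, mul_comm]

end PowerSeries

open PowerSeries

/-- The moment generating series `∑ mₙ Xⁿ`. -/
noncomputable def momentSeries (μ : Measure ℝ) : ℝ⟦X⟧ := PowerSeries.mk (moment μ)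

/-- The generating series `1 + ∑ κₙ Xⁿ` of the free cumulants. -/
noncomputable def cumulantSeries (μ : Measure ℝ) : ℝ⟦X⟧ := 1 + PowerSeries.mk (freeCumulant μ)

@[simp]
theorem coeff_momentSeries (μ : Measure ℝ) (n : ℕ) : coeff n (momentSeries μ) = moment μ n :=
  coeff_mk _ _

theorem freeCumulant_zero (μ : Measure ℝ) : freeCumulant μ 0 = 0 := by
  rw [freeCumulant]

theorem freeCumulant_succ (μ : Measure ℝ) (n : ℕ) :
    freeCumulant μ (n + 1) = moment μ (n + 1) -
      ∑ s ∈ Finset.range n,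
        freeCumulant μ (s + 1) * coeff (n - s) (momentSeries μ ^ (s + 1)) := by
  rw [freeCumulant, ← Finset.sum_attach (Finset.range n)]
  simp only [coeff_pow_eq_sum_antidiagonalTuple, coeff_momentSeries]

theorem constantCoeff_momentSeries (μ : Measure ℝ) [IsProbabilityMeasure μ] :
    constantCoeff (momentSeries μ) = 1 := by
  rw [← coeff_zero_eq_constantCoeff_apply]
  simp [moment]

theorem moment_succ (μ : Measure ℝ) [IsProbabilityMeasure μ] (n : ℕ) :
    moment μ (n + 1) = ∑ s ∈ Finset.range (n + 1),
      freeCumulant μ (s + 1) * coeff (n - s) (momentSeries μ ^ (s + 1)) := by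
  rw [Finset.sum_range_succ, freeCumulant_succ μ n]
  simp [constantCoeff_momentSeries]

theorem freeCumulant_eq_of_moment_succ (μ : Measure ℝ) [IsProbabilityMeasure μ] (c : ℕ → ℝ)
    (hc0 : c 0 = 0)
    (hc : ∀ n, moment μ (n + 1) = ∑ s ∈ Finset.range (n + 1),
      c (s + 1) * coeff (n - s) (momentSeries μ ^ (s + 1))) (n : ℕ) :
    freeCumulant μ n = c n := by
  induction n using Nat.strong_induction_on with
  | _ n ih =>
    rcases n with _ | n
    · rw [freeCumulant_zero, hc0]
    · rw [freeCumulant_succ, hc n, Finset.sum_range_succ]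
      rw [Finset.sum_congr rfl fun s hs => by
        rw [← ih (s + 1) (by have := Finset.mem_range.mp hs; omega)]]
      simp [constantCoeff_momentSeries]

theorem cumulantSeries_subst (μ : Measure ℝ) [IsProbabilityMeasure μ] :
    (cumulantSeries μ).subst (X * momentSeries μ) = momentSeries μ := by
  ext n
  rw [coeff_subst_eq_sum_range (by simp) (lt_add_one n), Finset.sum_range_succ']
  rcases n with _ | n
  · simp [cumulantSeries, freeCumulant_zero, moment]
  · rw [coeff_momentSeries, moment_succ]
    simp only [pow_zero, coeff_one, Nat.succ_ne_zero, if_false, mul_zero, add_zero]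
    refine Finset.sum_congr rfl fun s hs => ?_
    have hs := Finset.mem_range.mp hs
    obtain ⟨m, rfl⟩ := Nat.exists_eq_add_of_le (Nat.lt_succ_iff.mp hs)
    rw [mul_pow, show s + m + 1 = m + (s + 1) by ring, coeff_X_pow_mul]
    simp [cumulantSeries, coeff_one]

theorem X_mul_momentSeries_fixedPoint (μ : Measure ℝ) [IsProbabilityMeasure μ] :
    X * momentSeries μ = X * (cumulantSeries μ).subst (X * momentSeries μ) := by
  rw [cumulantSeries_subst]

/-- Free convolution with a law whose only nonzero free cumulant is `κ₂ = t`
(a semicircle law of variance `t`), in terms of moments. -/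
theorem moment_of_freeCumulant_eq_add {ρ μ : Measure ℝ} [IsProbabilityMeasure ρ]
    [IsProbabilityMeasure μ] {t : ℝ}
    (h : ∀ n, freeCumulant ρ n = (if n = 2 then t else 0) + freeCumulant μ n) (k : ℕ) :
    (k + 1) * moment ρ k =
      coeff k ((1 + C t * (X * (X * momentSeries μ))) ^ (k + 1) *
        d⁄dX ℝ (X * momentSeries μ)) := by
  set G := X * momentSeries μ with hG
  set A := X * momentSeries ρ with hA
  set H : ℝ⟦X⟧ := 1 + C t * (X * G) with hH
  have hH0 : constantCoeff H ≠ 0 := by simp [hH]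
  have hinv : H * H⁻¹ = 1 := PowerSeries.mul_inv_cancel H hH0
  have hP : HasSubst (X * H⁻¹) := HasSubst.of_constantCoeff_zero' (by simp)
  have hGs : HasSubst G := HasSubst.of_constantCoeff_zero' (by simp [hG])
  have hAs : HasSubst A := HasSubst.of_constantCoeff_zero' (by simp [hA])
  have hC : cumulantSeries ρ = cumulantSeries μ + C t * X ^ 2 := by
    ext n
    simp only [cumulantSeries, map_add, coeff_mk, h, coeff_C_mul, coeff_X_pow]
    split_ifs <;> ring
  have hAfix : A.subst (X * H⁻¹) =
      X * H⁻¹ * (cumulantSeries ρ).subst (A.subst (X * H⁻¹)) := by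
    conv_lhs => rw [hA, X_mul_momentSeries_fixedPoint, ← hA]
    rw [subst_mul hP, subst_X hP, subst_comp_subst_apply hAs hP]
  have hGfix : G = X * H⁻¹ * (cumulantSeries ρ).subst G := by
    have h1 : (C t * X ^ 2 : ℝ⟦X⟧).subst G = C t * G ^ 2 := by
      rw [subst_mul hGs, subst_pow hGs, subst_X hGs, subst_C]
      rfl
    rw [hC, subst_add hGs, h1, hG, cumulantSeries_subst, ← hG]
    have : X * (momentSeries μ + C t * G ^ 2) = G * H := by
      rw [hH, hG]; ring
    linear_combination (-H⁻¹) * this - G * hinv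
  have := coeff_of_subst_X_mul_inv_eq hH0
    (eq_of_eq_mul_subst (dvd_mul_right X H⁻¹) hAfix hGfix) k
  rw [this, hA, coeff_succ_X_mul, coeff_momentSeries]

theorem isProbabilityMeasure_unif {a b : ℝ} (h : a < b) : IsProbabilityMeasure (unif a b) := by
  refine ⟨?_⟩
  simp only [unif, Measure.smul_apply, Measure.restrict_apply_univ, Real.volume_Icc, smul_eq_mul]
  exact ENNReal.inv_mul_cancel (by simpa using h) ENNReal.ofReal_ne_top

theorem moment_unif {a b : ℝ} (h : a < b) (n : ℕ) :
    moment (unif a b) n = (b ^ (n + 1) - a ^ (n + 1)) / ((b - a) * (n + 1)) := by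
  rw [moment, unif, integral_smul_measure, integral_Icc_eq_integral_Ioc,
    ← intervalIntegral.integral_of_le h.le, integral_pow, ENNReal.toReal_inv,
    ENNReal.toReal_ofReal (sub_nonneg.mpr h.le), smul_eq_mul]
  have := (sub_pos.mpr h).ne'
  field_simp

theorem moment_unif_symm {t : ℝ} (ht : 0 < t) (n : ℕ) :
    moment (unif (-t / 2) (t / 2)) n = (t / 2) ^ n * (1 + (-1) ^ n) / (2 * (n + 1)) := by
  rw [moment_unif (by linarith), neg_div, neg_pow (t / 2)]
  field_simp
  ring

theorem moment_unif_symm_nonneg {t : ℝ} (ht : 0 < t) (n : ℕ) :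
    0 ≤ moment (unif (-t / 2) (t / 2)) n := by
  rw [moment_unif_symm ht]
  have : (0 : ℝ) ≤ 1 + (-1) ^ n := by
    rcases neg_one_pow_eq_or ℝ n with h | h <;> rw [h] <;> norm_num
  positivity

theorem derivative_X_mul_momentSeries_unif {t : ℝ} (ht : 0 < t) :
    (1 - C (t / 2) * X) * (1 + C (t / 2) * X) *
      d⁄dX ℝ (X * momentSeries (unif (-t / 2) (t / 2))) = 1 := by
  have hsq : (1 - C (t / 2) * X) * (1 + C (t / 2) * X) = 1 - C ((t / 2) ^ 2) * (X ^ 2 : ℝ⟦X⟧) := by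
    rw [map_pow]; ring
  have hc (k : ℕ) : coeff k (d⁄dX ℝ (X * momentSeries (unif (-t / 2) (t / 2)))) =
      (t / 2) ^ k * (1 + (-1) ^ k) / 2 := by
    rw [coeff_derivative, coeff_succ_X_mul, coeff_momentSeries, moment_unif_symm ht]
    field_simp
  rw [hsq, sub_mul, one_mul, mul_assoc]
  ext k
  rw [map_sub, coeff_C_mul, coeff_one, hc]
  rcases k with _ | _ | k
  · simp [coeff_X_pow_mul']
  · simp [coeff_X_pow_mul']
  · rw [coeff_X_pow_mul _ 2 k, hc]
    simp only [Nat.add_eq_zero_iff, one_ne_zero, and_false, if_false]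
    ring

theorem integral_sqrt_sq_sub_sq {R : ℝ} (hR : 0 < R) :
    ∫ x in (-R)..R, √(R ^ 2 - x ^ 2) = Real.pi * R ^ 2 / 2 := by
  have h := intervalIntegral.smul_integral_comp_mul_left (a := -1) (b := 1)
    (fun x => √(R ^ 2 - x ^ 2)) R
  have h1 (x : ℝ) : √(R ^ 2 - (R * x) ^ 2) = R * √(1 - x ^ 2) := by
    rw [show R ^ 2 - (R * x) ^ 2 = R ^ 2 * (1 - x ^ 2) by ring, Real.sqrt_mul (sq_nonneg R),
      Real.sqrt_sq hR.le]
  simp only [h1, intervalIntegral.integral_const_mul, integral_sqrt_one_sub_sq, smul_eq_mul,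
    mul_neg, mul_one] at h
  rw [← h]; ring

theorem integral_pow_mul_sqrt_odd (R : ℝ) {n : ℕ} (hn : Odd n) :
    ∫ x in (-R)..R, x ^ n * √(R ^ 2 - x ^ 2) = 0 := by
  have h := intervalIntegral.integral_comp_neg (a := -R) (b := R)
    (fun x => x ^ n * √(R ^ 2 - x ^ 2))
  simp only [hn.neg_pow, neg_sq, neg_mul, intervalIntegral.integral_neg, neg_neg] at h
  linarith

theorem integral_pow_add_two_mul_sqrt {R : ℝ} (hR : 0 < R) (n : ℕ) :
    (n + 4) * ∫ x in (-R)..R, x ^ (n + 2) * √(R ^ 2 - x ^ 2) =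
      (n + 1) * R ^ 2 * ∫ x in (-R)..R, x ^ n * √(R ^ 2 - x ^ 2) := by
  have hderiv (x : ℝ) (hx : x ∈ Set.Ioo (-R) R) :
      HasDerivAt (fun x => x ^ (n + 1) * ((R ^ 2 - x ^ 2) * √(R ^ 2 - x ^ 2)))
        ((n + 1) * R ^ 2 * (x ^ n * √(R ^ 2 - x ^ 2)) -
          (n + 4) * (x ^ (n + 2) * √(R ^ 2 - x ^ 2))) x := by
    have hpos : 0 < R ^ 2 - x ^ 2 := by nlinarith [hx.1, hx.2]
    have h1 : HasDerivAt (fun x => R ^ 2 - x ^ 2) (-(2 * x)) x := by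
      simpa using (hasDerivAt_pow 2 x).const_sub (R ^ 2)
    refine ((hasDerivAt_pow (n + 1) x).mul (h1.mul (h1.sqrt hpos.ne'))).congr_deriv ?_
    have hs : √(R ^ 2 - x ^ 2) ≠ 0 := (Real.sqrt_pos.mpr hpos).ne'
    have hsq := Real.sq_sqrt hpos.le
    simp only [Nat.add_sub_cancel, Pi.mul_apply]
    push_cast
    field_simp
    rw [hsq]
    ring
  have hcont (m : ℕ) : Continuous fun x : ℝ => x ^ m * √(R ^ 2 - x ^ 2) := by fun_prop
  have hint := intervalIntegral.integral_eq_sub_of_hasDerivAt_of_le (by linarith : -R ≤ R)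
    (by fun_prop) hderiv
    ((by fun_prop : Continuous fun x : ℝ => (n + 1) * R ^ 2 * (x ^ n * √(R ^ 2 - x ^ 2)) -
          (n + 4) * (x ^ (n + 2) * √(R ^ 2 - x ^ 2))).intervalIntegrable _ _)
  rw [intervalIntegral.integral_sub (((hcont n).const_mul _).intervalIntegrable _ _)
    (((hcont (n + 2)).const_mul _).intervalIntegrable _ _),
    intervalIntegral.integral_const_mul, intervalIntegral.integral_const_mul] at hint
  simp only [neg_sq, sub_self, zero_mul, mul_zero] at hint
  linarith

theorem moment_semicircle {R : ℝ} (hR : 0 < R) (n : ℕ) :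
    moment (semicircle R) n =
      2 / (Real.pi * R ^ 2) * ∫ x in (-R)..R, x ^ n * √(R ^ 2 - x ^ 2) := by
  rw [moment, semicircle, integral_withDensity_eq_integral_toReal_smul (by fun_prop) (by simp),
    integral_Icc_eq_integral_Ioc, ← intervalIntegral.integral_of_le (by linarith),
    ← intervalIntegral.integral_const_mul]
  refine intervalIntegral.integral_congr fun x _ => ?_
  simp only [smul_eq_mul]
  rw [ENNReal.toReal_ofReal (by positivity)]
  ring

theorem isProbabilityMeasure_semicircle {R : ℝ} (hR : 0 < R) :
    IsProbabilityMeasure (semicircle R) := by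
  have h := moment_semicircle hR 0
  simp only [moment, pow_zero, one_mul, integral_sqrt_sq_sub_sq hR, integral_const, smul_eq_mul,
    mul_one] at h
  refine ⟨(ENNReal.toReal_eq_one_iff _).mp ?_⟩
  rw [← measureReal_def, h]
  field_simp

theorem moment_semicircle_odd {R : ℝ} (hR : 0 < R) {n : ℕ} (hn : Odd n) :
    moment (semicircle R) n = 0 := by
  rw [moment_semicircle hR, integral_pow_mul_sqrt_odd R hn, mul_zero]

theorem add_two_mul_catalan_succ (k : ℕ) :
    (k + 2) * catalan (k + 1) = 2 * (2 * k + 1) * catalan k := by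
  have h := Nat.succ_mul_centralBinom_succ k
  rw [← succ_mul_catalan_eq_centralBinom, ← succ_mul_catalan_eq_centralBinom] at h
  refine Nat.eq_of_mul_eq_mul_left (Nat.succ_pos k) ?_
  simp only [Nat.succ_eq_add_one]
  linarith

theorem moment_semicircle_even {t : ℝ} (ht : 0 < t) (k : ℕ) :
    moment (semicircle (2 * √t)) (2 * k) = t ^ k * catalan k := by
  have hR : 0 < 2 * √t := by positivity
  have := isProbabilityMeasure_semicircle hR
  induction k with
  | zero => simp [moment]
  | succ k ih =>
    have h := integral_pow_add_two_mul_sqrt hR (2 * k)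
    have hsq : (2 * √t) ^ 2 = 4 * t := by rw [mul_pow, Real.sq_sqrt ht.le]; norm_num
    rw [moment_semicircle hR] at ih ⊢
    have hcat : ((k : ℝ) + 2) * catalan (k + 1) = 2 * (2 * k + 1) * catalan k := by
      exact_mod_cast add_two_mul_catalan_succ k
    push_cast at h
    refine mul_left_cancel₀ (by positivity : (2 * (k : ℝ) + 4) ≠ 0) ?_
    rw [mul_add_one 2 k, mul_left_comm, h, mul_left_comm, ih, hsq]
    linear_combination (-2 * t ^ (k + 1)) * hcat

theorem momentSeries_semicircle {t : ℝ} (ht : 0 < t) :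
    momentSeries (semicircle (2 * √t)) =
      1 + C t * X ^ 2 * momentSeries (semicircle (2 * √t)) ^ 2 := by
  have hR : 0 < 2 * √t := by positivity
  have hq0 : constantCoeff (C t * X ^ 2 : ℝ⟦X⟧) = 0 := by simp
  have hq := HasSubst.of_constantCoeff_zero' hq0
  have hM : momentSeries (semicircle (2 * √t)) =
      (catalanSeries.map (Nat.castRingHom ℝ)).subst (C t * X ^ 2 : ℝ⟦X⟧) := by
    ext n
    rw [coeff_subst_eq_sum_range hq0 (lt_add_one n), coeff_momentSeries]
    simp only [coeff_map, catalanSeries_coeff, mul_pow, ← map_pow, ← pow_mul, coeff_C_mul,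
      coeff_X_pow]
    rcases Nat.even_or_odd' n with ⟨k, rfl | rfl⟩
    · rw [moment_semicircle_even ht, Finset.sum_eq_single k]
      · simp [mul_comm]
      · intro d _ hd
        rw [if_neg (by omega)]
        simp
      · intro h
        exact absurd (Finset.mem_range.mpr (by omega)) h
    · rw [moment_semicircle_odd hR ⟨k, rfl⟩, Finset.sum_eq_zero]
      intro d _
      rw [if_neg (by omega)]
      simp
  have h := congrArg
    (fun f => (f.map (Nat.castRingHom ℝ)).subst (C t * X ^ 2 : ℝ⟦X⟧)) catalanSeries_sq_mul_X_add_one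
  simp only [map_add, map_mul, map_pow, map_X, map_one, ← coe_substAlgHom hq] at h
  rw [substAlgHom_X hq, coe_substAlgHom hq, ← hM] at h
  linear_combination -h

theorem freeCumulant_semicircle {t : ℝ} (ht : 0 < t) (n : ℕ) :
    freeCumulant (semicircle (2 * √t)) n = if n = 2 then t else 0 := by
  have := isProbabilityMeasure_semicircle (by positivity : 0 < 2 * √t)
  refine freeCumulant_eq_of_moment_succ _ (fun n => if n = 2 then t else 0) (by simp)
    (fun n => ?_) n
  have h := congrArg (coeff (n + 1)) (momentSeries_semicircle ht)
  rw [coeff_momentSeries, map_add, mul_assoc, coeff_C_mul, coeff_one,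
    if_neg n.succ_ne_zero, zero_add] at h
  rw [h]
  rcases n with _ | n
  · simp [coeff_X_pow_mul']
  · rw [coeff_X_pow_mul _ 2 n, Finset.sum_eq_single 1]
    · simp
    · intro s _ hs
      simp [hs]
    · intro h
      exact absurd (Finset.mem_range.mpr (by omega)) h

theorem exists_ae_abs_le_of_compact_support {μ : Measure ℝ}
    (h : ∃ K : Set ℝ, IsCompact K ∧ μ Kᶜ = 0) : ∃ R : ℝ, ∀ᵐ x ∂μ, |x| ≤ R := by
  obtain ⟨K, hK, hμ⟩ := h
  obtain ⟨R, hR⟩ := hK.isBounded.exists_norm_le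
  refine ⟨R, ?_⟩
  have : ∀ᵐ x ∂μ, x ∈ K := hμ
  filter_upwards [this] with x hx using hR x hx

theorem hasSum_complexMGF {μ : Measure ℝ} [IsFiniteMeasure μ]
    (h : ∃ K : Set ℝ, IsCompact K ∧ μ Kᶜ = 0) (z : ℂ) :
    HasSum (fun k : ℕ => z ^ k / (k.factorial : ℂ) * (moment μ k : ℂ))
      (ProbabilityTheory.complexMGF id μ z) := by
  obtain ⟨R, hR⟩ := exists_ae_abs_le_of_compact_support h
  have hterm (k : ℕ) : z ^ k / (k.factorial : ℂ) * (moment μ k : ℂ) =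
      ∫ x : ℝ, (z * x) ^ k / (k.factorial : ℂ) ∂μ := by
    rw [moment, ← integral_complex_ofReal, ← integral_const_mul]
    congr 1 with x
    push_cast
    ring
  simp only [hterm]
  refine hasSum_integral_of_dominated_convergence
    (fun k _ => (‖z‖ * R) ^ k / (k.factorial : ℝ)) (fun k => by fun_prop) (fun k => ?_)
    (.of_forall fun x => Real.summable_pow_div_factorial _) (by fun_prop) ?_
  · filter_upwards [hR] with x hx
    rw [norm_div, norm_pow, norm_mul, Complex.norm_real, Complex.norm_natCast, Real.norm_eq_abs]
    gcongr
  · refine .of_forall fun x => ?_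
    rw [Complex.exp_eq_exp_ℂ]
    exact NormedSpace.expSeries_div_hasSum_exp _

theorem measure_eq_of_moment_eq {μ ν : Measure ℝ} [IsFiniteMeasure μ] [IsFiniteMeasure ν]
    (hμ : ∃ K : Set ℝ, IsCompact K ∧ μ Kᶜ = 0) (hν : ∃ K : Set ℝ, IsCompact K ∧ ν Kᶜ = 0)
    (h : ∀ n, moment μ n = moment ν n) : μ = ν := by
  refine Measure.ext_of_complexMGF_id_eq (funext fun z => ?_)
  have h1 := hasSum_complexMGF hμ z
  simp only [h] at h1
  exact h1.unique (hasSum_complexMGF hν z)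

theorem hasSum_moment_map_exp {μ : Measure ℝ} [IsFiniteMeasure μ]
    (h : ∃ K : Set ℝ, IsCompact K ∧ μ Kᶜ = 0) (n : ℕ) :
    HasSum (fun k : ℕ => (n : ℝ) ^ k / (k.factorial : ℝ) * moment μ k)
      (moment (μ.map Real.exp) n) := by
  have h1 := hasSum_complexMGF h n
  rw [← Complex.hasSum_ofReal]
  convert h1 using 1
  · push_cast
    rfl
  · rw [moment, integral_map (by fun_prop) (by fun_prop), ProbabilityTheory.complexMGF,
      ← integral_complex_ofReal]
    congr 1 with x
    simp [← Complex.exp_nat_mul]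

theorem hasSum_of_hasSum_antidiagonal {a : ℕ × ℕ → ℝ} (ha : ∀ p, 0 ≤ a p) {S : ℝ}
    (h : HasSum (fun k => ∑ p ∈ Finset.HasAntidiagonal.antidiagonal k, a p) S) : HasSum a S := by
  rw [← Finset.HasAntidiagonal.sigmaAntidiagonalEquivProd.hasSum_iff]
  have hs : Summable (a ∘ Finset.HasAntidiagonal.sigmaAntidiagonalEquivProd) := by
    refine (summable_sigma_of_nonneg fun _ => ha _).mpr ?_
    refine ⟨fun k => (hasSum_fintype _).summable, h.summable.congr fun k => ?_⟩
    rw [tsum_fintype, ← Finset.sum_coe_sort]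
    rfl
  convert hs.hasSum
  refine h.unique (hs.hasSum.sigma fun k => ?_)
  rw [← Finset.sum_coe_sort]
  exact hasSum_fintype _

theorem hasSum_pow_div_factorial_mul_choose (y : ℝ) (j : ℕ) :
    HasSum (fun l : ℕ => y ^ l / ((l + 1).factorial : ℝ) * ((l + 1).choose (j + 1) : ℝ))
      (Real.exp y * (y ^ j / ((j + 1).factorial : ℝ))) := by
  rw [← (add_left_injective j).hasSum_iff]
  · rw [Real.exp_eq_exp_ℝ]
    refine ((NormedSpace.expSeries_div_hasSum_exp y).mul_right _).congr_fun fun m => ?_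
    rw [Function.comp_apply, Nat.cast_choose ℝ (by omega : j + 1 ≤ m + j + 1),
      show m + j + 1 - (j + 1) = m by omega]
    have := Nat.factorial_ne_zero (m + j + 1)
    field_simp
    ring
  · intro l hl
    have : l < j := by
      by_contra h
      exact hl ⟨l - j, by simp; omega⟩
    rw [Nat.choose_eq_zero_of_lt (by omega)]
    simp

namespace PowerSeries

theorem inv_one_sub_C_mul_X (a : ℝ) : (1 - C a * X : ℝ⟦X⟧)⁻¹ = rescale a (mk 1) := by
  rw [PowerSeries.inv_eq_iff_mul_eq_one (by simp)]
  have := congrArg (rescale a) (mk_one_mul_one_sub_eq_one ℝ)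
  rwa [map_mul, map_sub, map_one, rescale_X] at this

theorem coeff_inv_one_sub_C_mul_X_pow (a : ℝ) (d m : ℕ) :
    coeff m ((1 - C a * X : ℝ⟦X⟧)⁻¹ ^ (d + 1)) = a ^ m * ((d + m).choose d : ℝ) := by
  rw [inv_one_sub_C_mul_X, ← map_pow, coeff_rescale, mk_one_pow_eq_mk_choose_add, coeff_mk]

theorem coeff_one_add_pow_mul_inv_one_sub_pow (a : ℝ) (n l : ℕ) :
    coeff l ((1 + C a * X : ℝ⟦X⟧) ^ n * (1 - C a * X : ℝ⟦X⟧)⁻¹ ^ (n + 2)) =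
      a ^ l * ∑ j ∈ Finset.range (n + 1), (n.choose j : ℝ) * 2 ^ j * ((l + 1).choose (j + 1)) := by
  set p : ℝ⟦X⟧ := 1 - C a * X with hp
  have hinv : p * p⁻¹ = 1 := PowerSeries.mul_inv_cancel p (by simp [hp])
  have hq : (1 + C a * X) * p⁻¹ = C (2 * a) * X * p⁻¹ + 1 := by
    have h2 : (C (2 * a) : ℝ⟦X⟧) = 2 * C a := by rw [map_mul, map_ofNat]
    have hX : 1 - C a * X - p = 0 := sub_eq_zero.mpr hp.symm
    clear_value p
    linear_combination hinv + p⁻¹ * hX - X * p⁻¹ * h2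
  rw [pow_add, ← mul_assoc, ← mul_pow, hq, add_pow, Finset.sum_mul, map_sum, Finset.mul_sum]
  refine Finset.sum_congr rfl fun j _ => ?_
  have hterm : (C (2 * a) * X * p⁻¹) ^ j * 1 ^ (n - j) * (n.choose j : ℝ⟦X⟧) * p⁻¹ ^ 2 =
      C ((n.choose j : ℝ) * (2 * a) ^ j) * (X ^ j * p⁻¹ ^ (j + 1 + 1)) := by
    simp only [map_mul, map_pow, map_natCast]
    ring
  rw [hterm, coeff_C_mul, coeff_X_pow_mul']
  split_ifs with h
  · obtain ⟨m, rfl⟩ := Nat.exists_eq_add_of_le h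
    rw [coeff_inv_one_sub_C_mul_X_pow, Nat.add_sub_cancel_left,
      show j + 1 + m = j + m + 1 by ring]
    ring
  · rw [Nat.choose_eq_zero_of_lt (by omega : l + 1 < j + 1)]
    simp

theorem exp_subst_mul_derivative {t : ℝ} {G : ℝ⟦X⟧} (hG0 : constantCoeff G = 0)
    (hG : (1 - C (t / 2) * X) * (1 + C (t / 2) * X) * d⁄dX ℝ G = 1) (n : ℕ) :
    (exp ℝ).subst (C ((n + 1 : ℝ) * t) * G) * d⁄dX ℝ G =
      (1 + C (t / 2) * X) ^ n * (1 - C (t / 2) * X : ℝ⟦X⟧)⁻¹ ^ (n + 2) := by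
  set p : ℝ⟦X⟧ := 1 - C (t / 2) * X with hp
  set q : ℝ⟦X⟧ := 1 + C (t / 2) * X with hq
  set c : ℝ := (n + 1 : ℝ) * t with hc
  have hpinv : p * p⁻¹ = 1 := PowerSeries.mul_inv_cancel p (by simp [hp])
  have hqinv : q * q⁻¹ = 1 := PowerSeries.mul_inv_cancel q (by simp [hq])
  have hcG0 : constantCoeff (C c * G) = 0 := by simp [hG0]
  have hcG := HasSubst.of_constantCoeff_zero' hcG0
  set E : ℝ⟦X⟧ := (exp ℝ).subst (C c * G) with hE
  have hE0 : constantCoeff E = 1 := by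
    rw [← coeff_zero_eq_constantCoeff_apply, hE, coeff_subst_eq_sum_range hcG0 zero_lt_one]
    simp
  have hdE : d⁄dX ℝ E = C c * d⁄dX ℝ G * E := by
    rw [hE, derivative_subst hcG, derivative_exp]
    simp only [Derivation.leibniz, derivative_C, smul_eq_mul, mul_zero, add_zero]
    ring
  have hdp : d⁄dX ℝ p = -C (t / 2) := by simp [hp]
  have hdq : d⁄dX ℝ q = C (t / 2) := by simp [hq]
  have hcC : C c = ((n : ℝ⟦X⟧) + 1) * (2 * C (t / 2)) := by
    rw [hc, map_mul, map_add, map_natCast, map_one, ← map_ofNat (C (R := ℝ)) 2, ← map_mul]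
    congr 2
    ring
  have hpq : p + q = 2 := by rw [hp, hq]; ring
  have hp0 : constantCoeff p = 1 := by simp [hp]
  have hq0 : constantCoeff q = 1 := by simp [hq]
  clear_value p q E
  have hone : E * p ^ (n + 1) * q⁻¹ ^ (n + 1) = 1 := by
    refine derivative.ext ?_ ?_
    · simp only [Derivation.leibniz, derivative_pow, derivative_inv', hdE, hdp, hdq, smul_eq_mul,
        Nat.add_sub_cancel, hcC, derivative_one]
      push_cast
      linear_combination ((n + 1) * C (t / 2) * E * p ^ n * q⁻¹ ^ n) *
        (2 * q⁻¹ ^ 2 * hG - q⁻¹ ^ 2 * hpq - (2 * d⁄dX ℝ G * p * q⁻¹ - q⁻¹) * hqinv)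
    · simp [hE0, hp0, hq0]
  have hpn : p ^ (n + 1) * p⁻¹ ^ (n + 1) = 1 := by rw [← mul_pow, hpinv, one_pow]
  have hqn : q ^ (n + 1) * q⁻¹ ^ (n + 1) = 1 := by rw [← mul_pow, hqinv, one_pow]
  have hE' : E = q ^ (n + 1) * p⁻¹ ^ (n + 1) := by
    linear_combination (q ^ (n + 1) * p⁻¹ ^ (n + 1)) * hone - E * hpn -
      E * p ^ (n + 1) * p⁻¹ ^ (n + 1) * hqn
  have hG' : d⁄dX ℝ G = p⁻¹ * q⁻¹ := by
    linear_combination p⁻¹ * q⁻¹ * hG - d⁄dX ℝ G * hpinv - d⁄dX ℝ G * p * p⁻¹ * hqinv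
  rw [hE', hG']
  linear_combination (q ^ n * p⁻¹ ^ (n + 2)) * hqinv

end PowerSeries

theorem coeff_one_add_pow_mul_eq_sum (t : ℝ) (G D : ℝ⟦X⟧) (k : ℕ) :
    coeff k ((1 + C t * (X * G)) ^ (k + 1) * D) =
      ∑ p ∈ Finset.HasAntidiagonal.antidiagonal k,
        ((k + 1).choose p.1 : ℝ) * t ^ p.1 * coeff p.2 (G ^ p.1 * D) := by
  have hterm (i : ℕ) : (C t * (X * G)) ^ i * 1 ^ (k + 1 - i) * ((k + 1).choose i : ℝ⟦X⟧) * D =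
      C (((k + 1).choose i : ℝ) * t ^ i) * (X ^ i * (G ^ i * D)) := by
    simp only [map_mul, map_pow, map_natCast]
    ring
  rw [Finset.Nat.sum_antidiagonal_eq_sum_range_succ_mk, add_comm (1 : ℝ⟦X⟧), add_pow,
    Finset.sum_mul, map_sum, Finset.sum_range_succ]
  simp only [hterm, coeff_C_mul]
  rw [coeff_X_pow_mul' _ (k + 1) k, if_neg (by omega), mul_zero, add_zero]
  refine Finset.sum_congr rfl fun i hi => ?_
  rw [coeff_X_pow_mul', if_pos (Nat.lt_succ_iff.mp (Finset.mem_range.mp hi))]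

theorem coeff_exp_subst_mul_eq_sum (x : ℝ) {G : ℝ⟦X⟧} (hG0 : constantCoeff G = 0) (D : ℝ⟦X⟧)
    (l : ℕ) :
    coeff l ((exp ℝ).subst (C x * G) * D) =
      ∑ i ∈ Finset.range (l + 1), x ^ i / (i.factorial : ℝ) * coeff l (G ^ i * D) := by
  have hxG0 : constantCoeff (C x * G) = 0 := by simp [hG0]
  rw [coeff_mul]
  simp only [coeff_mul _ (G ^ _), Finset.mul_sum]
  rw [Finset.sum_comm]
  refine Finset.sum_congr rfl fun p hp => ?_
  have hp := Finset.HasAntidiagonal.mem_antidiagonal.mp hp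
  rw [coeff_subst_eq_sum_range hxG0 (by omega : p.1 < l + 1), Finset.sum_mul]
  refine Finset.sum_congr rfl fun i _ => ?_
  rw [mul_pow, ← map_pow, coeff_C_mul, coeff_exp]
  simp
  ring

theorem coeff_pow_mul_eq_zero {G : ℝ⟦X⟧} (hG0 : constantCoeff G = 0) (D : ℝ⟦X⟧) {i l : ℕ}
    (h : l < i) : coeff l (G ^ i * D) = 0 :=
  X_pow_dvd_iff.mp ((pow_dvd_pow_of_dvd (X_dvd_iff.mpr hG0) i).mul_right D) l h

theorem coeff_mul_nonneg {f g : ℝ⟦X⟧} (hf : ∀ k, 0 ≤ coeff k f) (hg : ∀ k, 0 ≤ coeff k g)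
    (k : ℕ) : 0 ≤ coeff k (f * g) := by
  rw [coeff_mul]
  exact Finset.sum_nonneg fun p _ => mul_nonneg (hf _) (hg _)

theorem coeff_pow_nonneg {f : ℝ⟦X⟧} (hf : ∀ k, 0 ≤ coeff k f) (n k : ℕ) :
    0 ≤ coeff k (f ^ n) := by
  induction n generalizing k with
  | zero =>
    rw [pow_zero, coeff_one]
    split_ifs <;> norm_num
  | succ n ih =>
    rw [pow_succ]
    exact coeff_mul_nonneg ih hf k

/-- Reorganises a convergent series `∑ₖ xᵏ/(k+1)! [Xᵏ] (1 + tXG)ᵏ⁺¹ · dG/dX` as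
`∑ₗ xˡ/(l+1)! [Xˡ] exp(xtG) · dG/dX`. -/
theorem hasSum_coeff_exp_subst {t x S : ℝ} (ht : 0 ≤ t) (hx : 0 ≤ x) {G : ℝ⟦X⟧}
    (hG0 : constantCoeff G = 0) (hG : ∀ k, 0 ≤ coeff k G)
    (hS : HasSum (fun k : ℕ => x ^ k / ((k + 1).factorial : ℝ) *
      coeff k ((1 + C t * (X * G)) ^ (k + 1) * d⁄dX ℝ G)) S) :
    HasSum (fun l : ℕ => x ^ l / ((l + 1).factorial : ℝ) *
      coeff l ((exp ℝ).subst (C (x * t) * G) * d⁄dX ℝ G)) S := by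
  set a : ℕ × ℕ → ℝ := fun p => x ^ (p.1 + p.2) * t ^ p.1 /
    ((p.1.factorial : ℝ) * ((p.2 + 1).factorial : ℝ)) * coeff p.2 (G ^ p.1 * d⁄dX ℝ G) with ha
  have hD (k : ℕ) : 0 ≤ coeff k (d⁄dX ℝ G) := by
    rw [coeff_derivative]
    exact mul_nonneg (hG _) (by positivity)
  have ha0 (p : ℕ × ℕ) : 0 ≤ a p :=
    mul_nonneg (by positivity) (coeff_mul_nonneg (coeff_pow_nonneg hG p.1) hD p.2)
  have hsum : HasSum a S := by
    refine hasSum_of_hasSum_antidiagonal ha0 (hS.congr_fun fun k => ?_)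
    rw [coeff_one_add_pow_mul_eq_sum, Finset.mul_sum]
    refine Finset.sum_congr rfl fun p hp => ?_
    have hp := Finset.HasAntidiagonal.mem_antidiagonal.mp hp
    rw [← hp, Nat.cast_choose ℝ (by omega : p.1 ≤ p.1 + p.2 + 1),
      show p.1 + p.2 + 1 - p.1 = p.2 + 1 by omega]
    have := Nat.factorial_ne_zero (p.1 + p.2 + 1)
    simp only [ha]
    field_simp
  refine ((Equiv.prodComm ℕ ℕ).hasSum_iff.mpr hsum).prod_fiberwise fun l => ?_
  have hfin : HasSum (fun i => a (i, l)) (∑ i ∈ Finset.range (l + 1), a (i, l)) :=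
    hasSum_sum_of_ne_finset_zero fun i hi => by
      simp only [ha]
      rw [coeff_pow_mul_eq_zero hG0 _ (by simpa using hi), mul_zero]
  convert hfin using 1
  · rfl
  · rw [coeff_exp_subst_mul_eq_sum _ hG0, Finset.mul_sum]
    refine Finset.sum_congr rfl fun i _ => ?_
    simp only [ha]
    field_simp
    ring

theorem sum_choose_mul_pow_eq (n : ℕ) (t : ℝ) :
    1 / ((n + 1 : ℕ) : ℝ) * ∑ j ∈ Finset.range (n + 1),
      ((n + 1).choose (1 + j) : ℝ) * (((n + 1 : ℕ) : ℝ) * t) ^ j / (j.factorial : ℝ) =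
    ∑ j ∈ Finset.range (n + 1), (n.choose j : ℝ) * 2 ^ j *
      ((((n + 1 : ℕ) : ℝ) * (t / 2)) ^ j / ((j + 1).factorial : ℝ)) := by
  rw [Finset.mul_sum]
  refine Finset.sum_congr rfl fun j _ => ?_
  have h : ((n : ℝ) + 1) * n.choose j = (n + 1).choose (j + 1) * (j + 1) := by
    exact_mod_cast Nat.add_one_mul_choose_eq n j
  rw [add_comm 1 j, Nat.factorial_succ, mul_div_assoc' _ t, div_pow]
  push_cast
  field_simp
  linear_combination -((n + 1) * t) ^ j * h

theorem free_pos_mult_BM_eq_exp_pushforward (t : ℝ) (ht : 0 < t) (ν ρ : Measure ℝ)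
    [IsProbabilityMeasure ν] [IsProbabilityMeasure ρ]
    (hνc : ∃ K : Set ℝ, IsCompact K ∧ ν Kᶜ = 0)
    (hρc : ∃ K : Set ℝ, IsCompact K ∧ ρ Kᶜ = 0)
    (hν : ∀ n : ℕ, 1 ≤ n →
      moment ν n = Real.exp ((n : ℝ) * t / 2) * (1 / (n : ℝ)) *
        ∑ j ∈ Finset.range n,
          (n.choose (1 + j) : ℝ) * ((n : ℝ) * t) ^ j / (j.factorial : ℝ))
    (hρ : IsFreeAdd (semicircle (2 * Real.sqrt t)) (unif (-t / 2) (t / 2)) ρ) :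
    ν = Measure.map Real.exp ρ := by
  have := isProbabilityMeasure_unif (by linarith : -t / 2 < t / 2)
  have := Measure.isProbabilityMeasure_map (μ := ρ) Real.measurable_exp.aemeasurable
  have hmapc : ∃ K : Set ℝ, IsCompact K ∧ ρ.map Real.exp Kᶜ = 0 := by
    obtain ⟨K, hK, hK0⟩ := hρc
    have hKe := hK.image Real.continuous_exp
    refine ⟨_, hKe, ?_⟩
    rw [Measure.map_apply Real.measurable_exp hKe.isClosed.measurableSet.compl]
    exact measure_mono_null
      (fun x (hx : Real.exp x ∉ _) hxK => hx (Set.mem_image_of_mem _ hxK)) hK0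
  refine measure_eq_of_moment_eq hνc hmapc fun n => ?_
  rcases n with _ | n
  · simp [moment]
  set G := X * momentSeries (unif (-t / 2) (t / 2)) with hG
  have hG0 : constantCoeff G = 0 := by simp [hG]
  have hGnonneg (k : ℕ) : 0 ≤ coeff k G := by
    rcases k with _ | k
    · simp [hG]
    · rw [hG, coeff_succ_X_mul, coeff_momentSeries]
      exact moment_unif_symm_nonneg ht k
  have hmoment := hasSum_moment_map_exp hρc (n + 1)
  have hsum := hasSum_coeff_exp_subst ht.le (Nat.cast_nonneg (n + 1)) hG0 hGnonneg
    (hmoment.congr_fun fun k => by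
      rw [hG, ← moment_of_freeCumulant_eq_add
        (fun m => (hρ m).trans (by rw [freeCumulant_semicircle ht])), Nat.factorial_succ]
      push_cast
      field_simp)
  refine HasSum.unique ?_ hsum
  rw [hν _ (by omega), mul_assoc, sum_choose_mul_pow_eq, Finset.mul_sum]
  convert hasSum_sum (s := Finset.range (n + 1)) fun j _ =>
    (hasSum_pow_div_factorial_mul_choose (((n + 1 : ℕ) : ℝ) * (t / 2)) j).mul_left
      ((n.choose j : ℝ) * 2 ^ j) using 1
  · rfl
  · funext l
    have hexp := exp_subst_mul_derivative hG0 (derivative_X_mul_momentSeries_unif ht) n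
    rw [← Nat.cast_add_one] at hexp
    rw [hexp, coeff_one_add_pow_mul_inv_one_sub_pow, Finset.mul_sum, Finset.mul_sum]
    refine Finset.sum_congr rfl fun j _ => ?_
    rw [mul_pow]
    ring
  · refine Finset.sum_congr rfl fun j _ => ?_
    rw [mul_div_assoc]
    ring
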